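/- arXiv:2504.10964 — 2 statements merged into one kernel-verified Lean document; each statement's English description precedes it below -/
import Mathlib

section
/- Let ‖·‖ be a vector norm on ℝ^N with a compatible submultiplicative matrix norm (‖Ax‖ ≤ ‖A‖‖x‖ and ‖AB‖ ≤ ‖A‖‖B‖). Let Ξ and Ξ∞ be N×N matrices with Ξ Ξ∞ = Ξ∞, Ξ∞ Ξ = Ξ∞, Ξ∞ Ξ∞ = Ξ∞, and set σ := ‖Ξ − Ξ∞‖. Let α ≥ 0, x, w ∈ ℝ^N, and x′ := Ξx − αw. Then ‖x′ − Ξ∞x′‖ ≤ σ ‖x − Ξ∞x‖ + α ‖w − Ξ∞w‖. -/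
/-- with a vector norm and a compatible submultiplicative matrix
    norm, σ = ‖Ξ − Ξ∞‖ and x′ = Ξx − αw,
    ‖x′ − Ξ∞x′‖ ≤ σ‖x − Ξ∞x‖ + α‖w − Ξ∞w‖. -/
theorem stmt_8 (N : ℕ)
    (vnorm : (Fin N → ℝ) → ℝ) (mnorm : Matrix (Fin N) (Fin N) ℝ → ℝ)
    (hv0 : ∀ x, 0 ≤ vnorm x) (hvdef : ∀ x, vnorm x = 0 ↔ x = 0)
    (hvadd : ∀ x y, vnorm (x + y) ≤ vnorm x + vnorm y)
    (hvsmul : ∀ (c : ℝ) x, vnorm (c • x) = |c| * vnorm x)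
    (hcompat : ∀ (A : Matrix (Fin N) (Fin N) ℝ) (x : Fin N → ℝ),
      vnorm (A.mulVec x) ≤ mnorm A * vnorm x)
    (hsubmult : ∀ A B : Matrix (Fin N) (Fin N) ℝ, mnorm (A * B) ≤ mnorm A * mnorm B)
    (Xi Xiinf : Matrix (Fin N) (Fin N) ℝ)
    (h1 : Xi * Xiinf = Xiinf) (h2 : Xiinf * Xi = Xiinf) (h3 : Xiinf * Xiinf = Xiinf)
    (σ : ℝ) (hσ : σ = mnorm (Xi - Xiinf))
    (α : ℝ) (hα : 0 ≤ α) (x w : Fin N → ℝ)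
    (x' : Fin N → ℝ) (hx' : x' = Xi.mulVec x - α • w) :
    vnorm (x' - Xiinf.mulVec x')
      ≤ σ * vnorm (x - Xiinf.mulVec x) + α * vnorm (w - Xiinf.mulVec w) := by
  have key : x' - Xiinf.mulVec x'
      = (Xi - Xiinf).mulVec (x - Xiinf.mulVec x) + (-α) • (w - Xiinf.mulVec w) := by
    rw [hx']
    simp only [Matrix.mulVec_sub, Matrix.sub_mul, Matrix.sub_mulVec, Matrix.mulVec_smul,
      Matrix.mulVec_mulVec, h1, h2, h3, sub_self, Matrix.zero_mulVec]
    module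
  calc vnorm (x' - Xiinf.mulVec x')
      ≤ vnorm ((Xi - Xiinf).mulVec (x - Xiinf.mulVec x))
          + vnorm ((-α) • (w - Xiinf.mulVec w)) := key ▸ hvadd _ _
    _ ≤ σ * vnorm (x - Xiinf.mulVec x) + α * vnorm (w - Xiinf.mulVec w) := by
      rw [hvsmul, abs_neg, abs_of_nonneg hα, hσ]
      gcongr
      exact hcompat _ _
end

section
/- Let ‖·‖ be a vector norm on ℝ^N with a compatible submultiplicative matrix norm (‖Ax‖ ≤ ‖A‖‖x‖, ‖AB‖ ≤ ‖A‖‖B‖), and let d > 0 satisfy ‖a‖ ≤ d‖a‖₂ for all a ∈ ℝ^N. Let Ξ be an N×N column-stochastic matrix (𝟙ᵀΞ = 𝟙ᵀ), π ∈ ℝ^N with Ξπ = π and 𝟙ᵀπ = 1, Ξ∞ = π𝟙ᵀ, σ := ‖Ξ − Ξ∞‖, and ε := ‖I − Ξ∞‖₂. Let w, g, g′ ∈ ℝ^N with 𝟙ᵀw = 𝟙ᵀg, and set w′ = Ξw + g′ − g. Then ‖w′ − Ξ∞g′‖ ≤ σ ‖w − Ξ∞g‖ + d ε ‖g′ − g‖₂.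 In particular, if g = G(z) and g′ = G(z′) for a map G : ℝ^N → ℝ^N satisfying ‖G(z′) − G(z)‖₂ ≤ L‖z′ − z‖₂, then ‖w′ − Ξ∞g′‖ ≤ σ ‖w − Ξ∞g‖ + d ε L ‖z′ − z‖₂. -/
/-- Euclidean norm on ℝ^N. -/
noncomputable def enorm2 {N : ℕ} (x : Fin N → ℝ) : ℝ :=
  ‖(WithLp.equiv 2 (Fin N → ℝ)).symm x‖

/-- Spectral (operator 2-) norm of a matrix. -/
noncomputable def mnorm2 {N : ℕ} (A : Matrix (Fin N) (Fin N) ℝ) : ℝ :=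
  ‖Matrix.toEuclideanCLM (𝕜 := ℝ) A‖

theorem rankOne_mulVec {N : ℕ} (p x : Fin N → ℝ) :
    (Matrix.of fun i (_ : Fin N) => p i).mulVec x = (∑ i, x i) • p := by
  ext i
  simp [Matrix.mulVec, dotProduct, ← Finset.mul_sum, mul_comm]

theorem enorm2_mulVec_le {N : ℕ} (A : Matrix (Fin N) (Fin N) ℝ) (x : Fin N → ℝ) :
    enorm2 (A.mulVec x) ≤ mnorm2 A * enorm2 x :=
  (Matrix.toEuclideanCLM (𝕜 := ℝ) A).le_opNorm (WithLp.toLp 2 x)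

theorem tracking_error_eq {N : ℕ} (Xi : Matrix (Fin N) (Fin N) ℝ) (p w g g' : Fin N → ℝ)
    (heig : Xi.mulVec p = p) (hsum : ∑ i, p i = 1) (hwg : ∑ i, w i = ∑ i, g i) :
    let P : Matrix (Fin N) (Fin N) ℝ := Matrix.of fun i _ => p i
    Xi.mulVec w + g' - g - P.mulVec g' =
      (Xi - P).mulVec (w - P.mulVec g) + (1 - P).mulVec (g' - g) := by
  intro P
  have hP : P.mulVec p = p := by rw [rankOne_mulVec, hsum, one_smul]
  have hw : P.mulVec w = (∑ i, g i) • p := by rw [rankOne_mulVec, hwg]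
  have hg : P.mulVec g = (∑ i, g i) • p := rankOne_mulVec p g
  simp only [Matrix.sub_mulVec, Matrix.mulVec_sub, Matrix.one_mulVec, hg, hw,
    Matrix.mulVec_smul, heig, hP, sub_self, smul_zero]
  abel

/-- gradient-tracking contraction step. With Ξ column-stochastic,
    Ξπ = π, 𝟙ᵀπ = 1, Ξ∞ = π𝟙ᵀ, σ = ‖Ξ − Ξ∞‖, ε = ‖I − Ξ∞‖₂, 𝟙ᵀw = 𝟙ᵀg and
    w′ = Ξw + g′ − g, one has ‖w′ − Ξ∞g′‖ ≤ σ‖w − Ξ∞g‖ + dε‖g′ − g‖₂; and if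
    g = G(z), g′ = G(z′) with G L-Lipschitz (in ‖·‖₂), then
    ‖w′ − Ξ∞g′‖ ≤ σ‖w − Ξ∞g‖ + dεL‖z′ − z‖₂. -/
theorem stmt_14 (N : ℕ)
    (vnorm : (Fin N → ℝ) → ℝ) (mnorm : Matrix (Fin N) (Fin N) ℝ → ℝ)
    (hv0 : ∀ x, 0 ≤ vnorm x) (hvdef : ∀ x, vnorm x = 0 ↔ x = 0)
    (hvadd : ∀ x y, vnorm (x + y) ≤ vnorm x + vnorm y)
    (hvsmul : ∀ (c : ℝ) x, vnorm (c • x) = |c| * vnorm x)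
    (hcompat : ∀ (A : Matrix (Fin N) (Fin N) ℝ) (x : Fin N → ℝ),
      vnorm (A.mulVec x) ≤ mnorm A * vnorm x)
    (hsubmult : ∀ A B : Matrix (Fin N) (Fin N) ℝ, mnorm (A * B) ≤ mnorm A * mnorm B)
    (d : ℝ) (hd : 0 < d) (hdv : ∀ a : Fin N → ℝ, vnorm a ≤ d * enorm2 a)
    (Xi : Matrix (Fin N) (Fin N) ℝ) (hcol : ∀ j, ∑ i, Xi i j = 1)
    (piv : Fin N → ℝ) (heig : Xi.mulVec piv = piv) (hsum : ∑ i, piv i = 1)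
    (Xiinf : Matrix (Fin N) (Fin N) ℝ)
    (hXiinf : Xiinf = Matrix.of fun i _ => piv i)
    (σ : ℝ) (hσ : σ = mnorm (Xi - Xiinf))
    (ε : ℝ) (hε : ε = mnorm2 (1 - Xiinf))
    (w g g' : Fin N → ℝ) (hwg : ∑ i, w i = ∑ i, g i)
    (w' : Fin N → ℝ) (hw' : w' = Xi.mulVec w + g' - g) :
    vnorm (w' - Xiinf.mulVec g')
        ≤ σ * vnorm (w - Xiinf.mulVec g) + d * ε * enorm2 (g' - g) ∧
      ∀ (G : (Fin N → ℝ) → (Fin N → ℝ)) (L : ℝ) (z z' : Fin N → ℝ),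
        (∀ a b : Fin N → ℝ, enorm2 (G a - G b) ≤ L * enorm2 (a - b)) →
        g = G z → g' = G z' →
        vnorm (w' - Xiinf.mulVec g')
          ≤ σ * vnorm (w - Xiinf.mulVec g) + d * ε * L * enorm2 (z' - z) := by
  have key : vnorm (w' - Xiinf.mulVec g')
      ≤ σ * vnorm (w - Xiinf.mulVec g) + d * ε * enorm2 (g' - g) := by
    subst hXiinf hσ hε hw'
    rw [tracking_error_eq Xi piv w g g' heig hsum hwg, mul_assoc d]
    exact (hvadd _ _).trans (add_le_add (hcompat _ _) ((hdv _).trans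
      (mul_le_mul_of_nonneg_left (enorm2_mulVec_le _ _) hd.le)))
  refine ⟨key, fun G L z z' hG hg hg' => key.trans ?_⟩
  have hε0 : 0 ≤ ε := hε ▸ norm_nonneg _
  rw [mul_assoc (d * ε), hg, hg']
  gcongr
  exact hG z' z
end
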